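/- arXiv:1704.03504 — 2 statements merged into one kernel-verified Lean document; each statement's English description precedes it below -/
import Mathlib

section
/- Let δ ∈ ℤ⁺, let z₀, …, z_ν ∈ ℕ, and let P(z₀, z₁, …, z_ν) = Σ_{i₀+⋯+i_ν ≤ δ} a_{i₀,…,i_ν} z₀^{i₀}⋯z_ν^{i_ν} be a polynomial with integer coefficients satisfying |a_{i₀,…,i_ν}| ≤ L for some L ∈ ℤ⁺. Let p > 1 be an integer and let B, X ∈ p↑ with B > X > δ!·L·(1 + z₀ + z₁ + ⋯ + z_ν)^δ. Set n_i = (δ+1)^i for i ∈ ℕ, c = 1 + Σ_{i=0}^{ν} z_i B^{n_i}, and K = c^δ · Σ_{i₀+⋯+i_ν ≤ δ} i₀!⋯i_ν!(δ − i₀ − ⋯ − i_ν)!·a_{i₀,…,i_ν}·B^{n_{ν+1} − Σ_{s=0}^{ν} i_s n_s} + X·Σ_{i=0}^{(2δ+1)n_ν} B^i. Then B^{(2δ+1)n_ν} < K < B^{(2δ+1)n_ν + 1}, and P(z₀, …, z_ν) = 0 if and only if τ_p(K, (X − 1)·B^{n_{ν+1}}) = 0. -/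
/-- `τ_p(a, b)`: the number of carries occurring when `a` and `b` are added
in base `p`. -/
def carries (p a b : ℕ) : ℕ :=
  ((Finset.range (a + b + 1)).filter
    (fun i => p ^ (i + 1) ≤ a % p ^ (i + 1) + b % p ^ (i + 1))).card

theorem carries_eq_zero_iff {p : ℕ} (hp : 1 < p) (a b : ℕ) :
    carries p a b = 0 ↔ ∀ i, a % p ^ (i + 1) + b % p ^ (i + 1) < p ^ (i + 1) := by
  unfold carries
  rw [Finset.card_eq_zero, Finset.filter_eq_empty_iff]
  refine ⟨fun h i => ?_, fun h i _ => not_le.2 (h i)⟩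
  by_contra! hi
  refine h (Finset.mem_range.2 ?_) hi
  have h1 : i + 1 < p ^ (i + 1) := Nat.lt_pow_self hp
  have h2 := Nat.mod_le a (p ^ (i + 1))
  have h3 := Nat.mod_le b (p ^ (i + 1))
  omega

/-- Adding the block of `m` maximal digits at position `l` produces no carry exactly when
the corresponding block of the other summand vanishes. -/
theorem carries_pow_sub_one_mul_pow_eq_zero_iff {p : ℕ} (hp : 1 < p) (K l : ℕ) {m : ℕ}
    (hm : 0 < m) :
    carries p K ((p ^ m - 1) * p ^ l) = 0 ↔ p ^ m ∣ K / p ^ l := by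
  rw [carries_eq_zero_iff hp]
  have hY : 0 < p ^ l := by positivity
  have hX : 0 < p ^ m := by positivity
  have hlow : K % p ^ l < p ^ l := Nat.mod_lt _ hY
  constructor
  · intro h
    have h1 := h (l + m - 1)
    rw [Nat.sub_add_cancel (by omega), pow_add, Nat.mod_mul, mul_comm (p ^ m - 1),
      Nat.mul_mod_mul_left, Nat.mod_eq_of_lt (by omega : p ^ m - 1 < p ^ m)] at h1
    by_contra hd
    have h2 : 0 < K / p ^ l % p ^ m := Nat.pos_of_ne_zero fun h0 => hd (Nat.dvd_of_mod_eq_zero h0)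
    have h3 : p ^ l * p ^ m ≤ p ^ l * (K / p ^ l % p ^ m) + p ^ l * (p ^ m - 1) := by
      rw [← mul_add]
      exact Nat.mul_le_mul_left _ (by omega)
    linarith [Nat.zero_le (K % p ^ l)]
  · intro hd i
    rcases le_total (i + 1) l with hi | hi
    · rw [Nat.mod_eq_zero_of_dvd (Dvd.dvd.mul_left (pow_dvd_pow p hi) (p ^ m - 1)), add_zero]
      exact Nat.mod_lt _ (by positivity)
    obtain ⟨t, ht⟩ := Nat.exists_eq_add_of_le hi
    have hT : 0 < p ^ t := by positivity
    rw [ht, pow_add, Nat.mod_mul, mul_comm (p ^ m - 1), Nat.mul_mod_mul_left]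
    suffices h : K / p ^ l % p ^ t + (p ^ m - 1) % p ^ t + 1 ≤ p ^ t by
      have := Nat.mul_le_mul_left (p ^ l) h
      rw [mul_add, mul_add, mul_one] at this
      omega
    rcases le_total t m with htm | htm
    · rw [Nat.mod_eq_zero_of_dvd ((pow_dvd_pow p htm).trans hd), zero_add]
      exact Nat.mod_lt _ hT
    · have hXT : p ^ m ∣ p ^ t := pow_dvd_pow p htm
      have hu : p ^ m ∣ p ^ t - K / p ^ l % p ^ t :=
        Nat.dvd_sub hXT ((Nat.dvd_mod_iff hXT).2 hd)
      have hlt : K / p ^ l % p ^ t < p ^ t := Nat.mod_lt _ hT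
      have h1 := Nat.le_of_dvd (by omega) hu
      have h2 := Nat.mod_le (p ^ m - 1) (p ^ t)
      omega

theorem sum_range_mul_pow_lt {B : ℕ} {g : ℕ → ℕ} (hg : ∀ k, g k < B) (N : ℕ) :
    ∑ k ∈ Finset.range N, g k * B ^ k < B ^ N := by
  induction N with
  | zero => simp
  | succ N ih =>
    rw [Finset.sum_range_succ, pow_succ]
    have := Nat.mul_le_mul_right (B ^ N) (Nat.succ_le_of_lt (hg N))
    rw [Nat.succ_mul] at this
    linarith

theorem sum_range_mul_pow_div_mod {B : ℕ} {g : ℕ → ℕ} (hg : ∀ k, g k < B) {n N : ℕ}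
    (hn : n < N) : (∑ k ∈ Finset.range N, g k * B ^ k) / B ^ n % B = g n := by
  have hB : 0 < B := (Nat.zero_le _).trans_lt (hg 0)
  have key : ∃ r, ∑ k ∈ Finset.range N, g k * B ^ k
      = ∑ k ∈ Finset.range n, g k * B ^ k + B ^ n * (g n + B * r) := by
    have hn' : n + 1 ≤ N := hn
    clear hn
    induction N, hn' using Nat.le_induction with
    | base => exact ⟨0, by rw [Finset.sum_range_succ]; ring⟩
    | succ N hN ih =>
      obtain ⟨r, hr⟩ := ih
      obtain ⟨t, rfl⟩ := Nat.exists_eq_add_of_le hN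
      exact ⟨r + g (n + 1 + t) * B ^ t, by rw [Finset.sum_range_succ, hr]; ring⟩
  obtain ⟨r, hr⟩ := key
  rw [hr, Nat.add_mul_div_left _ _ (by positivity),
    Nat.div_eq_of_lt (sum_range_mul_pow_lt hg n), zero_add, Nat.add_mul_mod_self_left,
    Nat.mod_eq_of_lt (hg n)]

theorem sum_mul_pow_injective {δ m : ℕ} {d e : Fin m → ℕ} (hd : ∀ s, d s ≤ δ)
    (he : ∀ s, e s ≤ δ)
    (h : ∑ s, d s * (δ + 1) ^ (s : ℕ) = ∑ s, e s * (δ + 1) ^ (s : ℕ)) : d = e := by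
  induction m with
  | zero => exact Subsingleton.elim _ _
  | succ m ih =>
    have split : ∀ f : Fin (m + 1) → ℕ, ∑ s, f s * (δ + 1) ^ (s : ℕ)
        = f 0 + (δ + 1) * ∑ s : Fin m, f s.succ * (δ + 1) ^ (s : ℕ) := by
      intro f
      rw [Fin.sum_univ_succ, Finset.mul_sum]
      simp only [Fin.val_zero, pow_zero, mul_one, Fin.val_succ, pow_succ]
      congr 1
      exact Finset.sum_congr rfl fun s _ => by ring
    rw [split d, split e] at h
    have h0 : d 0 = e 0 := by
      have := congrArg (· % (δ + 1)) h
      simpa [Nat.add_mul_mod_self_left, Nat.mod_eq_of_lt (Nat.lt_succ_of_le (hd 0)),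
        Nat.mod_eq_of_lt (Nat.lt_succ_of_le (he 0))] using this
    rw [h0] at h
    have ht := ih (fun s => hd s.succ) (fun s => he s.succ)
      (Nat.eq_of_mul_eq_mul_left (Nat.succ_pos δ) (Nat.add_left_cancel h))
    funext s
    refine Fin.cases h0 (fun s => ?_) s
    exact congrFun ht s

theorem le_of_sum_le {ι : Type*} [Fintype ι] {d : ι → ℕ} {δ : ℕ} (h : ∑ s, d s ≤ δ) (s : ι) :
    d s ≤ δ :=
  (Finset.single_le_sum (fun _ _ => Nat.zero_le _) (Finset.mem_univ s)).trans h

theorem sum_mul_pow_le {δ ν : ℕ} {d : Fin (ν + 1) → ℕ} (h : ∑ s, d s ≤ δ) :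
    ∑ s, d s * (δ + 1) ^ (s : ℕ) ≤ δ * (δ + 1) ^ ν := by
  calc ∑ s, d s * (δ + 1) ^ (s : ℕ) ≤ ∑ s, d s * (δ + 1) ^ ν :=
        Finset.sum_le_sum fun s _ => Nat.mul_le_mul_left _
          (Nat.pow_le_pow_right (Nat.succ_pos δ) (Nat.lt_succ_iff.1 s.2))
    _ = (∑ s, d s) * (δ + 1) ^ ν := (Finset.sum_mul _ _ _).symm
    _ ≤ δ * (δ + 1) ^ ν := Nat.mul_le_mul_right _ h

open Polynomial in
/-- The polynomial `1 + ∑ zᵢ x ^ (δ + 1) ^ i`. -/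
noncomputable def codingPoly {ν : ℕ} (δ : ℕ) (z : Fin (ν + 1) → ℕ) : ℤ[X] :=
  1 + ∑ i : Fin (ν + 1), C (z i : ℤ) * X ^ ((δ + 1) ^ (i : ℕ))

open Polynomial in
/-- The polynomial `∑ d! (δ - |d|)! a_d x ^ ((δ + 1) ^ (ν + 1) - ∑ d_s (δ + 1) ^ s)`. -/
noncomputable def coeffPoly {ν : ℕ} (δ : ℕ) (P : MvPolynomial (Fin (ν + 1)) ℤ) : ℤ[X] :=
  ∑ d ∈ P.support,
    C ((((∏ s : Fin (ν + 1), (d s).factorial) * (δ - ∑ s : Fin (ν + 1), d s).factorial : ℕ) : ℤ)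
      * P.coeff d)
      * X ^ ((δ + 1) ^ (ν + 1) - ∑ s : Fin (ν + 1), d s * (δ + 1) ^ (s : ℕ))

open Polynomial in
theorem natDegree_codingPoly_le {ν : ℕ} (δ : ℕ) (z : Fin (ν + 1) → ℕ) :
    (codingPoly δ z).natDegree ≤ (δ + 1) ^ ν := by
  unfold codingPoly
  refine natDegree_add_le_of_degree_le (by simp) (natDegree_sum_le_of_forall_le _ _ fun i _ => ?_)
  exact (natDegree_C_mul_X_pow_le _ _).trans
    (Nat.pow_le_pow_right (Nat.succ_pos δ) (Nat.lt_succ_iff.1 i.2))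

open Polynomial in
theorem natDegree_coeffPoly_le {ν : ℕ} (δ : ℕ) (P : MvPolynomial (Fin (ν + 1)) ℤ) :
    (coeffPoly δ P).natDegree ≤ (δ + 1) ^ (ν + 1) :=
  natDegree_sum_le_of_forall_le _ _ fun _ _ =>
    (natDegree_C_mul_X_pow_le _ _).trans (Nat.sub_le _ _)

open Polynomial in
theorem coeff_codingPoly_nonneg {ν : ℕ} (δ : ℕ) (z : Fin (ν + 1) → ℕ) (k : ℕ) :
    0 ≤ (codingPoly δ z).coeff k := by
  unfold codingPoly
  rw [coeff_add, finsetSum_coeff]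
  refine add_nonneg ?_ (Finset.sum_nonneg fun i _ => ?_)
  · rw [coeff_one]; split_ifs <;> simp
  · rw [coeff_C_mul_X_pow]; split_ifs <;> simp

open Polynomial in
theorem coeff_pow_nonneg {f : ℤ[X]} (hf : ∀ k, 0 ≤ f.coeff k) (n k : ℕ) :
    0 ≤ (f ^ n).coeff k := by
  induction n generalizing k with
  | zero => rw [pow_zero, coeff_one]; split_ifs <;> simp
  | succ n ih =>
    rw [pow_succ, coeff_mul]
    exact Finset.sum_nonneg fun x _ => mul_nonneg (ih _) (hf _)

open Polynomial in
theorem abs_coeff_mul_le {f g : ℤ[X]} {M : ℤ} (hf : ∀ k, 0 ≤ f.coeff k)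
    (hg : ∀ k, |g.coeff k| ≤ M) (k : ℕ) : |(f * g).coeff k| ≤ M * f.eval 1 := by
  have hM : 0 ≤ M := (abs_nonneg _).trans (hg 0)
  have hsum : ∑ i ∈ Finset.range (k + 1), f.coeff i ≤ f.eval 1 := by
    rw [eval_eq_sum_range' (show f.natDegree < f.natDegree + k + 1 by omega)]
    simp only [one_pow, mul_one]
    exact Finset.sum_le_sum_of_subset_of_nonneg
      (Finset.range_subset_range.2 (by omega)) fun i _ _ => hf i
  rw [coeff_mul, Finset.Nat.sum_antidiagonal_eq_sum_range_succ_mk]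
  calc _ ≤ ∑ i ∈ Finset.range (k + 1), |f.coeff i * g.coeff (k - i)| :=
        Finset.abs_sum_le_sum_abs _ _
    _ ≤ ∑ i ∈ Finset.range (k + 1), M * f.coeff i := Finset.sum_le_sum fun i _ => by
        rw [abs_mul, abs_of_nonneg (hf i), mul_comm]
        exact mul_le_mul_of_nonneg_right (hg _) (hf i)
    _ ≤ M * f.eval 1 := by
        rw [← Finset.mul_sum]
        exact mul_le_mul_of_nonneg_left hsum hM

theorem sum_le_of_mem_support {ν δ : ℕ} {P : MvPolynomial (Fin (ν + 1)) ℤ}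
    (hdeg : P.totalDegree ≤ δ) {d : Fin (ν + 1) →₀ ℕ} (hd : d ∈ P.support) :
    ∑ s, d s ≤ δ := by
  have := (MvPolynomial.le_totalDegree hd).trans hdeg
  rwa [Finsupp.sum_fintype _ _ (fun _ => rfl)] at this

theorem prod_factorial_mul_factorial_sub_le {ι : Type*} [Fintype ι] {δ : ℕ} {d : ι → ℕ}
    (h : ∑ s, d s ≤ δ) :
    (∏ s, (d s).factorial) * (δ - ∑ s, d s).factorial ≤ δ.factorial := by
  have h1 : (∏ s, (d s).factorial) ∣ (∑ s, d s).factorial := Nat.prod_factorial_dvd_factorial_sum _ _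
  refine Nat.le_of_dvd (Nat.factorial_pos _) ((Nat.mul_dvd_mul_right h1 _).trans ?_)
  exact Nat.factorial_mul_factorial_dvd_factorial h

open Polynomial in
theorem abs_coeff_coeffPoly_le {ν δ L : ℕ} {P : MvPolynomial (Fin (ν + 1)) ℤ}
    (hdeg : P.totalDegree ≤ δ) (hcoeff : ∀ d, |P.coeff d| ≤ (L : ℤ)) (k : ℕ) :
    |(coeffPoly δ P).coeff k| ≤ (δ.factorial * L : ℕ) := by
  unfold coeffPoly
  rw [finsetSum_coeff]
  simp only [coeff_C_mul_X_pow]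
  by_cases hk : ∃ d ∈ P.support, k = (δ + 1) ^ (ν + 1) - ∑ s, d s * (δ + 1) ^ (s : ℕ)
  · obtain ⟨d, hd, rfl⟩ := hk
    have hexp : ∀ e ∈ P.support, ∑ s, e s * (δ + 1) ^ (s : ℕ) ≤ (δ + 1) ^ (ν + 1) := fun e he =>
      (sum_mul_pow_le (sum_le_of_mem_support hdeg he)).trans (by rw [pow_succ']; gcongr; omega)
    rw [Finset.sum_eq_single_of_mem d hd, if_pos rfl]
    · rw [abs_mul, Nat.abs_cast, Nat.cast_mul]
      refine mul_le_mul ?_ (hcoeff d) (abs_nonneg _) (Int.natCast_nonneg _)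
      exact_mod_cast prod_factorial_mul_factorial_sub_le (sum_le_of_mem_support hdeg hd)
    · intro e he hne
      refine if_neg fun h => hne ?_
      have h1 := hexp d hd
      have h2 := hexp e he
      exact DFunLike.coe_injective (sum_mul_pow_injective
        (le_of_sum_le (sum_le_of_mem_support hdeg he))
        (le_of_sum_le (sum_le_of_mem_support hdeg hd)) (by omega))
  · rw [Finset.sum_eq_zero fun d hd => if_neg fun h => hk ⟨d, hd, h⟩]
    rw [abs_zero]
    exact Int.natCast_nonneg _

open Polynomial in
theorem codingPoly_pow {ν : ℕ} (δ : ℕ) (z : Fin (ν + 1) → ℕ) :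
    codingPoly δ z ^ δ = ∑ j ∈ Finset.range (δ + 1),
      ∑ d ∈ Finset.piAntidiag (Finset.univ : Finset (Fin (ν + 1))) j,
        C ((δ.choose j * Nat.multinomial Finset.univ d * ∏ s, z s ^ d s : ℕ) : ℤ)
          * X ^ (∑ s, d s * (δ + 1) ^ (s : ℕ)) := by
  unfold codingPoly
  rw [add_comm, add_pow]
  refine Finset.sum_congr rfl fun j _ => ?_
  rw [Finset.sum_pow_eq_sum_piAntidiag, one_pow, mul_one, Finset.sum_mul]
  refine Finset.sum_congr rfl fun d _ => ?_
  simp only [mul_pow, Finset.prod_mul_distrib, ← pow_mul, Finset.prod_pow_eq_pow_sum]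
  simp only [Nat.cast_mul, Nat.cast_prod, Nat.cast_pow, map_mul, map_prod, map_pow, map_natCast,
    mul_comm (d _)]
  ring

open Polynomial in
theorem coeff_codingPoly_pow {ν δ : ℕ} (z : Fin (ν + 1) → ℕ) {d : Fin (ν + 1) → ℕ}
    (hd : ∑ s, d s ≤ δ) :
    ((codingPoly δ z) ^ δ).coeff (∑ s, d s * (δ + 1) ^ (s : ℕ))
      = ((δ.choose (∑ s, d s) * Nat.multinomial Finset.univ d * ∏ s, z s ^ d s : ℕ) : ℤ) := by
  rw [codingPoly_pow, finsetSum_coeff]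
  simp only [finsetSum_coeff, coeff_C_mul_X_pow]
  have hinj : ∀ j ∈ Finset.range (δ + 1),
      ∀ e ∈ Finset.piAntidiag (Finset.univ : Finset (Fin (ν + 1))) j,
      ∑ s, d s * (δ + 1) ^ (s : ℕ) = ∑ s, e s * (δ + 1) ^ (s : ℕ) → d = e := by
    intro j hj e he h
    have he' : ∑ s, e s = j := (Finset.mem_piAntidiag.1 he).1
    exact sum_mul_pow_injective (le_of_sum_le hd)
      (le_of_sum_le (he'.trans_le (Nat.lt_succ_iff.1 (Finset.mem_range.1 hj)))) h
  have hj : ∑ s, d s ∈ Finset.range (δ + 1) := Finset.mem_range.2 (Nat.lt_succ_of_le hd)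
  rw [Finset.sum_eq_single_of_mem _ hj, Finset.sum_eq_single_of_mem d, if_pos rfl]
  · exact Finset.mem_piAntidiag.2 ⟨rfl, fun _ _ => Finset.mem_univ _⟩
  · exact fun e he hne => if_neg fun h => hne (hinj _ hj e he h).symm
  · intro j hj' hne
    refine Finset.sum_eq_zero fun e he => if_neg fun h => hne ?_
    rw [hinj j hj' e he h]
    exact (Finset.mem_piAntidiag.1 he).1.symm

open Polynomial in
theorem coeff_codingPoly_pow_mul_coeffPoly {ν δ : ℕ} (z : Fin (ν + 1) → ℕ)
    {P : MvPolynomial (Fin (ν + 1)) ℤ} (hdeg : P.totalDegree ≤ δ) :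
    (codingPoly δ z ^ δ * coeffPoly δ P).coeff ((δ + 1) ^ (ν + 1))
      = δ.factorial * MvPolynomial.eval (fun i => (z i : ℤ)) P := by
  rw [MvPolynomial.eval_eq', Finset.mul_sum]
  conv_lhs => rw [coeffPoly, Finset.mul_sum, finsetSum_coeff]
  refine Finset.sum_congr rfl fun d hd => ?_
  have hsum := sum_le_of_mem_support hdeg hd
  have hexp : ∑ s, d s * (δ + 1) ^ (s : ℕ) ≤ (δ + 1) ^ (ν + 1) :=
    (sum_mul_pow_le hsum).trans (by rw [pow_succ']; gcongr; omega)
  rw [mul_left_comm, coeff_C_mul, coeff_mul_X_pow', if_pos (Nat.sub_le _ _), Nat.sub_sub_self hexp,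
    coeff_codingPoly_pow z hsum]
  have h1 : (∏ s, (d s).factorial) * Nat.multinomial Finset.univ d = (∑ s, d s).factorial :=
    Nat.multinomial_spec _ _
  have h2 := Nat.choose_mul_factorial_mul_factorial hsum
  rw [← h1] at h2
  rw [← h2]
  push_cast
  ring


theorem stmt10 (δ ν : ℕ) (hδ : 0 < δ) (z : Fin (ν + 1) → ℕ)
    (P : MvPolynomial (Fin (ν + 1)) ℤ) (hdeg : P.totalDegree ≤ δ)
    (L : ℕ) (hL : 0 < L) (hcoeff : ∀ d, |P.coeff d| ≤ (L : ℤ))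
    (p : ℕ) (hp : 1 < p) (B X : ℕ)
    (hB : ∃ m : ℕ, B = p ^ m) (hX : ∃ m : ℕ, X = p ^ m) (hXB : X < B)
    (hXlb : δ.factorial * L * (1 + ∑ i, z i) ^ δ < X)
    (c K : ℤ)
    (hc : c = 1 + ∑ i : Fin (ν + 1), (z i : ℤ) * (B : ℤ) ^ ((δ + 1) ^ (i : ℕ)))
    (hK : K = c ^ δ * ∑ d ∈ P.support,
        (((∏ s : Fin (ν + 1), (d s).factorial) * (δ - ∑ s : Fin (ν + 1), d s).factorial : ℕ) : ℤ)
          * P.coeff d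
          * (B : ℤ) ^ ((δ + 1) ^ (ν + 1) - ∑ s : Fin (ν + 1), d s * (δ + 1) ^ (s : ℕ))
      + (X : ℤ) * ∑ i ∈ Finset.range ((2 * δ + 1) * (δ + 1) ^ ν + 1), (B : ℤ) ^ i) :
    (B : ℤ) ^ ((2 * δ + 1) * (δ + 1) ^ ν) < K ∧
    K < (B : ℤ) ^ ((2 * δ + 1) * (δ + 1) ^ ν + 1) ∧
    (MvPolynomial.eval (fun i => (z i : ℤ)) P = 0 ↔
      carries p K.toNat ((X - 1) * B ^ ((δ + 1) ^ (ν + 1))) = 0) := by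
  obtain ⟨b, rfl⟩ := hB
  obtain ⟨m, rfl⟩ := hX
  set B := p ^ b with hBdef
  set n := (δ + 1) ^ (ν + 1) with hn
  set N := (2 * δ + 1) * (δ + 1) ^ ν with hN
  set Q := codingPoly δ z ^ δ * coeffPoly δ P with hQ
  have hmb : m < b := (Nat.pow_lt_pow_iff_right hp).1 hXB
  have hX1 : 1 < p ^ m := by
    refine lt_of_le_of_lt ?_ hXlb
    exact Nat.one_le_iff_ne_zero.2 (by positivity)
  have hm : 0 < m := Nat.pos_of_ne_zero (by rintro rfl; simp at hX1)
  have hXB2 : 2 * p ^ m ≤ B := by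
    calc 2 * p ^ m ≤ p * p ^ m := Nat.mul_le_mul_right _ hp
      _ = p ^ (m + 1) := (pow_succ' _ _).symm
      _ ≤ B := Nat.pow_le_pow_right (by omega) hmb
  have hbound : ∀ k, |Q.coeff k| < (p ^ m : ℕ) := by
    intro k
    refine (abs_coeff_mul_le (coeff_pow_nonneg (coeff_codingPoly_nonneg δ z) δ)
      (abs_coeff_coeffPoly_le hdeg hcoeff) k).trans_lt ?_
    have : (codingPoly δ z ^ δ).eval 1 = (((1 + ∑ i, z i) ^ δ : ℕ) : ℤ) := by
      simp [codingPoly, Polynomial.eval_finsetSum]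
    rw [this]
    exact_mod_cast hXlb
  have hdegQ : Q.natDegree < N + 1 := by
    have h1 : (codingPoly δ z ^ δ).natDegree ≤ δ * (δ + 1) ^ ν :=
      Polynomial.natDegree_pow_le_of_le δ (natDegree_codingPoly_le δ z)
    have h2 := natDegree_coeffPoly_le δ P
    have h3 : Q.natDegree ≤ _ := Polynomial.natDegree_mul_le
    have h4 : N = δ * (δ + 1) ^ ν + (δ + 1) ^ (ν + 1) := by rw [hN]; ring
    omega
  have hKsum : K = ∑ k ∈ Finset.range (N + 1), ((p ^ m : ℕ) + Q.coeff k) * (B : ℤ) ^ k := by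
    have hc' : (codingPoly δ z).eval (B : ℤ) = c := by
      simp [codingPoly, Polynomial.eval_finsetSum, hc]
    have hQeval : Q.eval (B : ℤ) = c ^ δ * (coeffPoly δ P).eval (B : ℤ) := by
      rw [hQ, Polynomial.eval_mul, Polynomial.eval_pow, hc']
    simp only [add_mul, Finset.sum_add_distrib, ← Finset.mul_sum]
    rw [← Polynomial.eval_eq_sum_range' hdegQ, hQeval, hK, add_comm]
    simp only [coeffPoly, Polynomial.eval_finsetSum, Polynomial.eval_mul, Polynomial.eval_C,
      Polynomial.eval_pow, Polynomial.eval_X, ← hn]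
  obtain ⟨g, hg⟩ : ∃ g : ℕ → ℕ, ∀ k, (g k : ℤ) = (p ^ m : ℕ) + Q.coeff k :=
    ⟨fun k => ((p ^ m : ℕ) + Q.coeff k).toNat, fun k => Int.toNat_of_nonneg (by
      have := (abs_lt.1 (hbound k)).1; omega)⟩
  have hgpos : ∀ k, 0 < g k := fun k => by
    have := (abs_lt.1 (hbound k)).1; have := hg k; omega
  have hgB : ∀ k, g k < B := fun k => by
    have := (abs_lt.1 (hbound k)).2; have := hg k; omega
  have hKnat : K = (∑ k ∈ Finset.range (N + 1), g k * B ^ k : ℕ) := by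
    rw [hKsum]; push_cast [hg]; rfl
  have hNpos : 0 < N := by positivity
  have hnN : n < N + 1 := by
    have : N = n + δ * (δ + 1) ^ ν := by rw [hN, hn]; ring
    omega
  refine ⟨?_, ?_, ?_⟩
  · rw [hKnat]
    norm_cast
    rw [Finset.sum_range_succ]
    have h1 : 0 < ∑ k ∈ Finset.range N, g k * B ^ k :=
      Finset.sum_pos (fun k _ => Nat.mul_pos (hgpos k) (by positivity))
        (Finset.nonempty_range_iff.2 hNpos.ne')
    have h2 := Nat.le_mul_of_pos_left (B ^ N) (hgpos N)
    omega
  · rw [hKnat]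
    exact_mod_cast sum_range_mul_pow_lt hgB (N + 1)
  · have hdvd : p ^ m ∣ B := pow_dvd_pow p hmb.le
    rw [hBdef, ← pow_mul, carries_pow_sub_one_mul_pow_eq_zero_iff hp _ _ hm, pow_mul, ← hBdef,
      ← Nat.dvd_mod_iff hdvd, hKnat, Int.toNat_natCast, sum_range_mul_pow_div_mod hgB hnN,
      ← Int.natCast_dvd_natCast, hg, dvd_add_right (dvd_refl _)]
    have hco := coeff_codingPoly_pow_mul_coeffPoly z hdeg
    rw [← hQ, ← hn] at hco
    constructor
    · intro h0
      rw [hco, h0, mul_zero]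
      exact dvd_zero _
    · intro h
      have := Int.eq_zero_of_abs_lt_dvd h (hbound n)
      rw [hco, mul_eq_zero] at this
      exact this.resolve_left (by exact_mod_cast δ.factorial_ne_zero)
end

section
/- Let p be a prime, let b ∈ p↑ and g ∈ ℤ⁺, and let P, Q, X, Y be integers with P > Q > 0 and X, Y ≥ b. Suppose Y divides the binomial coefficient C(PX, QX). Then there exist integers h, k, l, w, x, y, all ≥ b, such that, with L, U, V, W, K, A, B, C, D, E, F, G, H, I defined from these data as in the context: D·F·I ∈ □, (U^{2P}V² − 4)K² + 4 ∈ □, pA − p² − 1 divides (p² − 1)WC − p(W² − 1), b·w = p^B, and 16g²(C − KL)² < K². -/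
/-- The Lucas sequence `0, 1, a, a² - 1, …` with recurrence `uₙ₊₂ = a uₙ₊₁ - uₙ`. -/
def lucasU (a : ℤ) : ℕ → ℤ
  | 0 => 0
  | 1 => 1
  | n + 2 => a * lucasU a (n + 1) - lucasU a n

namespace lucasU

theorem add_two (a : ℤ) (n : ℕ) :
    lucasU a (n + 2) = a * lucasU a (n + 1) - lucasU a n := by
  rw [lucasU]

theorem norm_eq_one (a : ℤ) (n : ℕ) :
    lucasU a (n + 1) ^ 2 - a * lucasU a (n + 1) * lucasU a n + lucasU a n ^ 2 = 1 := by
  induction n with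
  | zero => simp [lucasU]
  | succ n ih => rw [add_two]; linear_combination ih

theorem congr_modEq {a b m : ℤ} (h : a ≡ b [ZMOD m]) (n : ℕ) :
    lucasU a n ≡ lucasU b n [ZMOD m] := by
  induction n using Nat.twoStepInduction with
  | zero => exact Int.ModEq.rfl
  | one => exact Int.ModEq.rfl
  | more n h₀ h₁ => rw [add_two, add_two]; exact (h.mul h₁).sub h₀

theorem two (n : ℕ) : lucasU 2 n = n := by
  induction n using Nat.twoStepInduction with
  | zero => rfl
  | one => rfl
  | more n h₀ h₁ => rw [add_two, h₀, h₁]; push_cast; ring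

theorem sub_two_dvd (a : ℤ) (n : ℕ) : a - 2 ∣ lucasU a n - n := by
  have h := congr_modEq (show (2 : ℤ) ≡ a [ZMOD a - 2] from Int.modEq_iff_dvd.2 dvd_rfl) n
  rw [two] at h
  exact Int.modEq_iff_dvd.1 h

theorem nonneg_and_lt_succ {a : ℤ} (ha : 2 ≤ a) (n : ℕ) :
    0 ≤ lucasU a n ∧ lucasU a n + 1 ≤ lucasU a (n + 1) := by
  induction n with
  | zero => simp [lucasU]
  | succ n ih =>
    rw [add_two]
    refine ⟨by lia, ?_⟩
    nlinarith [ih.1, ih.2]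

theorem natCast_le {a : ℤ} (ha : 2 ≤ a) (n : ℕ) : (n : ℤ) ≤ lucasU a n := by
  induction n with
  | zero => simp [lucasU]
  | succ n ih => have := (nonneg_and_lt_succ ha n).2; push_cast; lia

theorem linear_le {a : ℤ} (ha : 2 ≤ a) (n : ℕ) :
    (n + 1 : ℤ) + (a - 2) * n ≤ lucasU a (n + 1) := by
  cases n with
  | zero => simp [lucasU]
  | succ n =>
    rw [add_two]
    have h₁ := (nonneg_and_lt_succ ha n).2
    have h₂ := natCast_le ha (n + 1)
    push_cast at h₂ ⊢
    nlinarith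

theorem pow_le {a : ℤ} (ha : 2 ≤ a) (n : ℕ) : (a - 1) ^ n ≤ lucasU a (n + 1) := by
  induction n with
  | zero => simp [lucasU]
  | succ n ih =>
    rw [add_two, pow_succ]
    have h₁ := (nonneg_and_lt_succ ha n).2
    nlinarith

theorem le_pow {a : ℤ} (ha : 2 ≤ a) (n : ℕ) : lucasU a (n + 1) ≤ a ^ n := by
  induction n with
  | zero => simp [lucasU]
  | succ n ih =>
    rw [add_two, pow_succ]
    have h₁ := (nonneg_and_lt_succ ha n).1
    nlinarith

theorem dvd_mul_pow_sub (a p : ℤ) (n : ℕ) :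
    p * a - p ^ 2 - 1 ∣ (p ^ 2 - 1) * p ^ n * lucasU a n - p * ((p ^ n) ^ 2 - 1) := by
  induction n using Nat.twoStepInduction with
  | zero => simp [lucasU]
  | one => simp only [lucasU]; exact ⟨0, by ring⟩
  | more n h₀ h₁ =>
    obtain ⟨c, hc⟩ := h₀
    obtain ⟨d, hd⟩ := h₁
    refine ⟨p * (p ^ (n + 1)) ^ 2 - p + p * a * d - p ^ 2 * c, ?_⟩
    rw [add_two]
    simp only [pow_succ] at *
    linear_combination p * a * hd - p ^ 2 * hc

/-- The sequence is periodic modulo every positive integer, hence hits `0` at large indices. -/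
theorem exists_dvd (a b : ℤ) {N : ℤ} (hN : 0 < N) (ha : 2 ≤ a) :
    ∃ m x : ℕ, b ≤ x ∧ lucasU a m = N * x := by
  lift N to ℕ using hN.le
  have : NeZero N := ⟨by rintro rfl; simp at hN⟩
  let T : Equiv.Perm (ZMod N × ZMod N) :=
    { toFun := fun z => (z.2, a * z.2 - z.1)
      invFun := fun z => (a * z.1 - z.2, z.1)
      left_inv := fun z => by ext <;> simp
      right_inv := fun z => by ext <;> simp }
  have hT (n : ℕ) : (T ^ n) (0, 1) = ((lucasU a n : ZMod N), (lucasU a (n + 1) : ZMod N)) := by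
    induction n with
    | zero => simp [lucasU]
    | succ n ih => rw [pow_succ', Equiv.Perm.mul_apply, ih, add_two]; simp [T]
  set m := orderOf T * (N * b.toNat) with hm
  have h := hT m
  rw [hm, pow_mul, pow_orderOf_eq_one, one_pow] at h
  have h0 : ((lucasU a m : ℤ) : ZMod N) = 0 := by simpa using (congrArg Prod.fst h).symm
  obtain ⟨x, hx⟩ := (ZMod.intCast_zmod_eq_zero_iff_dvd _ _).1 h0
  have hle := natCast_le ha m
  have hmN : N * b.toNat ≤ m := Nat.le_mul_of_pos_left _ (orderOf_pos T)
  have hbx : (b.toNat : ℤ) ≤ x := by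
    refine le_of_mul_le_mul_left ?_ hN
    rw [← hx]
    exact le_trans (mod_cast hmN) hle
  lift x to ℕ using by lia
  exact ⟨m, x, by lia, hx⟩

end lucasU

/-- Separating the terms of degree at least `s` in the expansion of `(V + 1) ^ (s + t + 1)`. -/
theorem exists_add_one_pow_eq {V : ℤ} (hV : 1 ≤ V) (s t : ℕ) :
    ∃ L e : ℤ, (V + 1) ^ (s + t + 1) = L * V ^ s + e ∧ 0 ≤ e ∧
      e * V ≤ 2 ^ (s + t + 1) * V ^ s ∧ V ∣ L - (s + t + 1).choose s ∧ V ≤ L := by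
  set r := s + t + 1 with hr
  refine ⟨∑ i ∈ Finset.range (t + 2), V ^ i * r.choose (s + i),
    ∑ i ∈ Finset.range s, V ^ i * r.choose i, ?_, ?_, ?_, ?_, ?_⟩
  · rw [add_pow, show r + 1 = s + (t + 2) by lia, Finset.sum_range_add, add_comm, Finset.sum_mul]
    congr 1
    · refine Finset.sum_congr rfl fun i _ => ?_
      rw [one_pow, pow_add]; ring
    · simp
  · exact Finset.sum_nonneg fun i _ => by positivity
  · rw [Finset.sum_mul]
    calc ∑ i ∈ Finset.range s, V ^ i * r.choose i * V
        ≤ ∑ i ∈ Finset.range s, (r.choose i : ℤ) * V ^ s := by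
          refine Finset.sum_le_sum fun i hi => ?_
          have : V ^ (i + 1) ≤ V ^ s := pow_le_pow_right₀ hV (Finset.mem_range.1 hi)
          calc V ^ i * r.choose i * V = r.choose i * V ^ (i + 1) := by ring
            _ ≤ _ := by gcongr
      _ ≤ ∑ i ∈ Finset.range (r + 1), (r.choose i : ℤ) * V ^ s :=
          Finset.sum_le_sum_of_subset_of_nonneg
            (Finset.range_subset_range.2 (by lia)) fun i _ _ => by positivity
      _ = 2 ^ r * V ^ s := by
          rw [← Finset.sum_mul]
          congr 1
          exact_mod_cast Nat.sum_range_choose r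
  · rw [Finset.sum_range_succ']
    simp only [pow_zero, one_mul, add_zero, add_sub_cancel_right]
    exact Finset.dvd_sum fun i _ => (Dvd.intro_left (V ^ i) (pow_succ V i).symm).mul_right _
  · calc V = V ^ 1 := (pow_one V).symm
      _ ≤ V ^ (t + 1) := pow_le_pow_right₀ hV (by lia)
      _ = V ^ (t + 1) * (r.choose (s + (t + 1)) : ℕ) := by
          rw [show s + (t + 1) = r by lia]; simp
      _ ≤ _ := Finset.single_le_sum (f := fun i => V ^ i * (r.choose (s + i) : ℤ))
          (fun i _ => by positivity) (Finset.mem_range.2 (by lia))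

set_option maxHeartbeats 1000000 in
/-- A solution `x, y` making `D`, `F` and `I` squares when `C` is the `B`-th Lucas number. -/
theorem exists_mul_eq_sq {A b : ℤ} {n : ℕ} (hA : 3 ≤ A) (hb : 1 ≤ b) (hn : 2 * b ≤ n) :
    ∃ x y : ℤ, b ≤ x ∧ b ≤ y ∧
      let B : ℤ := n + 1
      let C := lucasU A (n + 1)
      let D := (A ^ 2 - 4) * C ^ 2 + 4
      let E := C ^ 2 * D * x
      let F := 4 * (A ^ 2 - 4) * E ^ 2 + 1
      let G := 1 + C * D * F - 2 * (A + 2) * (A - 2) ^ 2 * E ^ 2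
      let H := C + B * F + (2 * y - 1) * C * F
      let I := (G ^ 2 - 1) * H ^ 2 + 1
      ∃ m : ℤ, D * F * I = m ^ 2 := by
  have hBC : (n : ℤ) + 1 ≤ lucasU A (n + 1) := by
    exact_mod_cast lucasU.natCast_le (by lia) (n + 1)
  have hCA : 1 + n + (A - 2) * n ≤ lucasU A (n + 1) := by
    linarith [lucasU.linear_le (a := A) (by lia) n]
  have hC₀ := lucasU.norm_eq_one A (n + 1)
  set C := lucasU A (n + 1) with hC
  set D := (A ^ 2 - 4) * C ^ 2 + 4 with hD
  have hCpos : 0 < C := by lia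
  have hA4 : 0 < A ^ 2 - 4 := by nlinarith
  have hDC : C ≤ D := by nlinarith
  have hDA : A ≤ D := by nlinarith
  obtain ⟨m, x, hbx, hx⟩ :=
    lucasU.exists_dvd A b (N := 4 * (C ^ 2 * D)) (by positivity) (by lia)
  set E := C ^ 2 * D * x with hE
  set F := 4 * (A ^ 2 - 4) * E ^ 2 + 1 with hF
  set G := 1 + C * D * F - 2 * (A + 2) * (A - 2) ^ 2 * E ^ 2 with hG
  have hFpos : 1 ≤ F := by rw [hF]; nlinarith [mul_nonneg hA4.le (sq_nonneg E)]
  have hCDF : 0 < C * D * F := by positivity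
  have hGD : C * D * F < 2 * G - 1 := by
    have h₁ : (A ^ 2 - 4) * E ^ 2 * A ≤ (A ^ 2 - 4) * E ^ 2 * (C * D) := by
      gcongr
      calc A = 1 * A := (one_mul A).symm
        _ ≤ C * D := by gcongr; lia
    have h₂ : 0 ≤ (A ^ 2 - 4) * E ^ 2 := by positivity
    have h₃ : 0 < C * D := by positivity
    rw [hG, hF]
    linarith
  have hH := lucasU.linear_le (a := 2 * G) (by lia) n
  have hHF : lucasU (2 * G) (n + 1) ≡ C [ZMOD F] :=
    lucasU.congr_modEq (Int.modEq_iff_dvd.2 ⟨A - 2 - 2 * C * D, by rw [hG, hF]; ring⟩) _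
  have hHC : lucasU (2 * G) (n + 1) ≡ n + 1 [ZMOD 2 * C] := by
    have h : 2 * G ≡ 2 [ZMOD 2 * C] := Int.modEq_iff_dvd.2
      ⟨-(D * F - 2 * (A + 2) * (A - 2) ^ 2 * (C ^ 3 * D ^ 2 * x ^ 2)), by rw [hG, hE]; ring⟩
    have := lucasU.congr_modEq h (n + 1)
    rwa [lucasU.two, Nat.cast_succ] at this
  have hI₀ := lucasU.norm_eq_one (2 * G) (n + 1)
  set H := lucasU (2 * G) (n + 1) with hHdef
  obtain ⟨c, hc⟩ := Int.modEq_iff_dvd.1 hHF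
  obtain ⟨d, hd⟩ := Int.modEq_iff_dvd.1 hHC
  have hcop : IsCoprime C F :=
    ⟨-(4 * (A ^ 2 - 4) * E * (C * D * x)), 1, by rw [hF]; nth_rewrite 3 [sq]; nth_rewrite 3 [hE]; ring⟩
  have hdvd : C * F ∣ H - C - (n + 1) * F := by
    refine hcop.mul_dvd ⟨-1 - 2 * d - (n + 1) * (4 * (A ^ 2 - 4) * E * (C * D * x)), ?_⟩
      ⟨-c - (n + 1), by linear_combination -hc⟩
    have : F = 1 + C * (4 * (A ^ 2 - 4) * E * (C * D * x)) := by
      rw [hF, hE]; ring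
    linear_combination -hd - (n + 1) * this
  obtain ⟨t, ht⟩ := hdvd
  have hodd : Odd t := by
    have h : C * (F * t) = C * (2 * (-1 - d - (n + 1) * (2 * (A ^ 2 - 4) * E * (C * D * x))) + 1) := by
      have : F = 1 + C * (4 * (A ^ 2 - 4) * E * (C * D * x)) := by
        rw [hF, hE]; ring
      linear_combination -ht - hd - (n + 1) * this
    exact (Int.odd_mul.1 ⟨_, mul_left_cancel₀ hCpos.ne' h⟩).2
  obtain ⟨z, hz⟩ := hodd
  have hbt : 2 * b - 1 ≤ t := by
    refine le_of_mul_le_mul_left ?_ (show 0 < C * F by positivity)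
    rw [← ht]
    have h₁ : C * F * (2 * b + 1) ≤ C * F * D := by
      gcongr
      lia
    have h₂ : (n + 1) * F ≤ C * F := by gcongr
    have h₃ : C ≤ C * F := le_mul_of_one_le_right hCpos.le hFpos
    have h₄ : C * D * F ≤ H := by
      have h₅ : (2 * G - 2) * 1 ≤ (2 * G - 2) * n := by
        gcongr <;> lia
      linarith
    linarith
  refine ⟨x, z + 1, hbx, by lia, ?_⟩
  intro B _ _ _ _ _ H' I
  have hH' : H' = H := by
    change C + (n + 1) * F + (2 * (z + 1) - 1) * C * F = H
    rw [hz] at ht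
    linear_combination -ht
  have hI : I = (lucasU (2 * G) (n + 1 + 1) - G * H) ^ 2 := by
    change (G ^ 2 - 1) * H' ^ 2 + 1 = _
    rw [hH']
    linear_combination -hI₀
  have hD' : D = (2 * lucasU A (n + 1 + 1) - A * C) ^ 2 := by
    rw [hD]; linear_combination -4 * hC₀
  have hF' : F = (lucasU A (m + 1) - 2 * A * E) ^ 2 := by
    have hm := lucasU.norm_eq_one A m
    rw [show lucasU A m = 4 * E by rw [hx, hE]; ring] at hm
    rw [hF]; linear_combination -hm
  refine ⟨(2 * lucasU A (n + 1 + 1) - A * C) * (lucasU A (m + 1) - 2 * A * E) *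
    (lucasU (2 * G) (n + 1 + 1) - G * H), ?_⟩
  change D * F * I = _
  rw [hI, mul_pow, mul_pow, ← hD', ← hF']

/-- If `C ≈ A ^ r` and `K ≈ M ^ s`, where `A ^ r / M ^ s = (V + 1) ^ r / V ^ s`, then `C / K`
approximates the integer part `L` of `(V + 1) ^ r / V ^ s`. -/
theorem abs_sub_lt_of_add_one_pow_eq {V L A M C K e : ℝ} {r s : ℕ} {g : ℝ}
    (hg : 1 ≤ g) (hr : 2 ≤ r) (hsr : s ≤ r) (hL : 1 ≤ L) (hV : 8 * g * 2 ^ r ≤ V)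
    (he : (V + 1) ^ r = L * V ^ s + e) (he₀ : 0 ≤ e) (heV : e * V ≤ 2 ^ r * V ^ s)
    (hA : r * L * V ≤ A) (hM : 2 * r * L * V ≤ M) (hAM : A ^ r * V ^ s = M ^ s * (V + 1) ^ r)
    (hCA : (A - 1) ^ r ≤ C) (hCA' : C ≤ A ^ r) (hKM : (M - 1) ^ s ≤ K) (hKM' : K ≤ M ^ s) :
    4 * g * |C - K * L| < K := by
  have h4 : (4 : ℝ) ≤ 2 ^ r := by
    calc (4 : ℝ) = 2 ^ 2 := by norm_num
      _ ≤ 2 ^ r := pow_le_pow_right₀ (by norm_num) hr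
  have hr' : (2 : ℝ) ≤ r := by exact_mod_cast hr
  have hsr' : (s : ℝ) ≤ r := by exact_mod_cast hsr
  have hV32 : 32 ≤ V := by
    have : 1 * 4 ≤ g * 2 ^ r := by gcongr
    linarith
  have hrLV : 64 ≤ r * L * V := by
    calc (64 : ℝ) = 2 * 1 * 32 := by norm_num
      _ ≤ r * L * V := by gcongr
  have hApos : 0 < A := by linarith
  have hMpos : 0 < M := by linarith
  have hVs : 0 < V ^ s := by positivity
  have hMs : 0 < M ^ s := by positivity
  obtain ⟨ρ, hρ⟩ : ∃ ρ, ρ = (V + 1) ^ r / V ^ s := ⟨_, rfl⟩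
  have hρL : L ≤ ρ := by
    rw [hρ, le_div_iff₀ hVs]; linarith
  have hρL' : (ρ - L) * V ≤ 2 ^ r := by
    have : (ρ - L) * V = e * V / V ^ s := by
      rw [hρ, he]; field_simp; ring
    rw [this, div_le_iff₀ hVs]; exact heV
  have hAρ : A ^ r = M ^ s * ρ := by
    rw [hρ]; field_simp; linarith
  have bern {a : ℝ} {n : ℕ} (ha : 1 ≤ a) : a ^ n * (1 - n / a) ≤ (a - 1) ^ n := by
    have h := one_add_mul_le_pow (a := -1 / a)
      (by rw [le_div_iff₀ (by linarith)]; linarith) n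
    calc a ^ n * (1 - n / a) = a ^ n * (1 + n * (-1 / a)) := by ring
      _ ≤ a ^ n * (1 + -1 / a) ^ n := by gcongr
      _ = (a - 1) ^ n := by
        rw [← mul_pow]; congr 1; field_simp; ring
  have hrA : r / A * (L * V) ≤ 1 := by
    rw [div_mul_eq_mul_div, div_le_one hApos]; linarith
  have hsM : s / M * (2 * L * V) ≤ 1 := by
    rw [div_mul_eq_mul_div, div_le_one hMpos]
    have : (s : ℝ) * (2 * L * V) ≤ r * (2 * L * V) := by gcongr
    linarith
  have hα₀ : 0 ≤ r / A := by positivity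
  have hβ₀ : 0 ≤ s / M := by positivity
  have hC₁ := (bern (n := r) (a := A) (by linarith)).trans hCA
  have hK₁ := (bern (n := s) (a := M) (by linarith)).trans hKM
  generalize (r / A : ℝ) = α at *
  generalize (s / M : ℝ) = β at *
  rw [hAρ] at hC₁ hCA'
  generalize M ^ s = N at *
  have hVpos : 0 < V := by linarith
  have hLV : 1 ≤ L * V := one_le_mul_of_one_le_of_one_le hL (by linarith)
  have hrV : 2 ^ r ≤ V := by
    refine le_trans ?_ hV
    exact le_mul_of_one_le_left (by positivity) (by linarith)
  have hρ2 : ρ ≤ 2 * L := by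
    have : ρ - L ≤ 1 := le_of_mul_le_mul_right (by linarith) hVpos
    linarith
  have hαρ : α * ρ * V ≤ 2 := by
    have : α * ρ * V ≤ α * (2 * L) * V := by gcongr
    linarith
  have hβρ : β * ρ * V ≤ 1 := by
    have : β * ρ * V ≤ β * (2 * L) * V := by gcongr
    linarith
  have hβ : β ≤ 1 / 2 := by
    linarith [mul_nonneg hβ₀ (sub_nonneg.2 hLV)]
  have hK : 0 < K := lt_of_lt_of_le (mul_pos hMs (by linarith)) hK₁
  have hNK : N ≤ K * (1 + 2 * β) := by
    have h₁ : N * (1 - β) * (1 + 2 * β) ≤ K * (1 + 2 * β) := by gcongr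
    have h₂ : 0 ≤ N * (β * (1 - 2 * β)) :=
      mul_nonneg hMs.le (mul_nonneg hβ₀ (by linarith))
    linarith
  have hup : (C - K * L) * V ≤ K * (2 ^ r + 2) := by
    have h₁ : C ≤ K * (1 + 2 * β) * ρ := hCA'.trans (by gcongr; linarith)
    calc (C - K * L) * V ≤ (K * (1 + 2 * β) * ρ - K * L) * V := by gcongr
      _ = K * ((ρ - L) * V + 2 * (β * ρ * V)) := by ring
      _ ≤ K * (2 ^ r + 2) := by gcongr; linarith
  have hlow : (K * L - C) * V ≤ K * (2 ^ r + 2) := by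
    have hα : α ≤ 1 := by linarith [mul_nonneg hα₀ (sub_nonneg.2 hLV)]
    have h₁ : K * (ρ * (1 - α)) ≤ C := by
      refine le_trans ?_ hC₁
      rw [mul_assoc]
      gcongr
      exact mul_nonneg (by linarith) (by linarith)
    calc (K * L - C) * V ≤ (K * L - K * (ρ * (1 - α))) * V := by gcongr
      _ = K * ((L - ρ) * V + α * ρ * V) := by ring
      _ ≤ K * (2 ^ r + 2) := by
        gcongr
        have := mul_nonneg (sub_nonneg.2 hρL) hVpos.le
        linarith
  have habs : |C - K * L| * V ≤ K * (2 ^ r + 2) := by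
    rcases abs_cases (C - K * L) with ⟨h, -⟩ | ⟨h, -⟩ <;> rw [h] <;> linarith
  refine lt_of_mul_lt_mul_right ?_ hVpos.le
  calc 4 * g * |C - K * L| * V = 4 * g * (|C - K * L| * V) := by ring
    _ ≤ 4 * g * (K * (2 ^ r + 2)) := by gcongr
    _ = K * (4 * g * (2 ^ r + 2)) := by ring
    _ < K * V := by
      gcongr
      have : g * 4 ≤ g * 2 ^ r := by gcongr
      linarith

theorem stmt16 (p : ℕ) (hp : p.Prime) (b g P Q X Y : ℤ)
    (hb : ∃ n : ℕ, b = (p : ℤ) ^ n) (hg : 0 < g)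
    (hQ : 0 < Q) (hPQ : Q < P) (hX : b ≤ X) (hY : b ≤ Y)
    (hdvd : Y ∣ ((P * X).toNat.choose (Q * X).toNat : ℤ)) :
    ∃ h k l w x y : ℤ, b ≤ h ∧ b ≤ k ∧ b ≤ l ∧ b ≤ w ∧ b ≤ x ∧ b ≤ y ∧
      let L := l * Y
      let U := P * L * X
      let V := 4 * g * w * Y
      let W := b * w
      let K := Q * X + 1 + k * (U ^ P.toNat * V - 2)
      let A := U ^ Q.toNat * (V + 1)
      let B := P * X + 1
      let C := B + (A - 2) * h
      let D := (A ^ 2 - 4) * C ^ 2 + 4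
      let E := C ^ 2 * D * x
      let F := 4 * (A ^ 2 - 4) * E ^ 2 + 1
      let G := 1 + C * D * F - 2 * (A + 2) * (A - 2) ^ 2 * E ^ 2
      let H := C + B * F + (2 * y - 1) * C * F
      let I := (G ^ 2 - 1) * H ^ 2 + 1
      (∃ m : ℤ, D * F * I = m ^ 2) ∧
      (∃ m : ℤ, (U ^ (2 * P.toNat) * V ^ 2 - 4) * K ^ 2 + 4 = m ^ 2) ∧
      ((p : ℤ) * A - (p : ℤ) ^ 2 - 1 ∣ ((p : ℤ) ^ 2 - 1) * W * C - (p : ℤ) * (W ^ 2 - 1)) ∧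
      b * w = (p : ℤ) ^ B.toNat ∧
      16 * g ^ 2 * (C - K * L) ^ 2 < K ^ 2 := by
  obtain ⟨n, hbn⟩ := hb
  have hp2 : (2 : ℤ) ≤ p := by exact_mod_cast hp.two_le
  have hb1 : 1 ≤ b := by rw [hbn]; exact one_le_pow₀ (by lia)
  have hnb : (n : ℤ) < b := by
    rw [hbn]; exact_mod_cast Nat.lt_pow_self hp.one_lt
  lift P to ℕ using by lia
  lift Q to ℕ using by lia
  lift X to ℕ using by lia
  obtain ⟨t, ht⟩ : ∃ t, P * X = Q * X + t + 1 := by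
    have : Q * X < P * X := Nat.mul_lt_mul_of_pos_right (by lia) (by lia)
    exact ⟨P * X - Q * X - 1, by lia⟩
  have hQX : X ≤ Q * X := Nat.le_mul_of_pos_left _ (by lia)
  have h2X : 2 * X ≤ P * X := Nat.mul_le_mul_right _ (by lia)
  have hrdef : ((P : ℤ) * X) = (P * X : ℕ) := by push_cast; rfl
  have hsdef : ((Q : ℤ) * X) = (Q * X : ℕ) := by push_cast; rfl
  have hPXdef : ((P : ℤ) * X + 1).toNat = P * X + 1 := by lia
  rw [hrdef, hsdef, Int.toNat_natCast, Int.toNat_natCast] at hdvd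
  -- the parameter `w`
  obtain ⟨w, hw⟩ : ∃ w : ℤ, w = (p : ℤ) ^ (P * X + 1 - n) := ⟨_, rfl⟩
  have hbw : b * w = (p : ℤ) ^ (P * X + 1) := by
    rw [hbn, hw, ← pow_add]; congr 1; lia
  have hwb : b ≤ w := by
    rw [hbn, hw]; exact pow_le_pow_right₀ (by lia) (by lia)
  obtain ⟨V, hV⟩ : ∃ V : ℤ, V = 4 * g * w * Y := ⟨_, rfl⟩
  have hwY : (2 : ℤ) ^ (P * X + 1) ≤ w * Y := by
    calc (2 : ℤ) ^ (P * X + 1) ≤ p ^ (P * X + 1) := by gcongr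
      _ = w * b := by rw [← hbw, mul_comm]
      _ ≤ w * Y := by gcongr; lia
  have hVr : 8 * g * 2 ^ (P * X) ≤ V := by
    calc 8 * g * 2 ^ (P * X) = 4 * g * 2 ^ (P * X + 1) := by ring
      _ ≤ 4 * g * (w * Y) := by gcongr
      _ = V := by rw [hV]; ring
  have hV8 : 8 ≤ V := by
    have : 1 * 1 ≤ g * 2 ^ (P * X) := mul_le_mul (by lia) (one_le_pow₀ (by lia)) (by lia) (by lia)
    linarith
  -- the parameter `l`
  obtain ⟨L, e, hLe, he₀, heV, hVL, hLV⟩ := exists_add_one_pow_eq (V := V) (by lia) (Q * X) t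
  rw [← ht] at hLe heV hVL
  obtain ⟨l, hl⟩ : Y ∣ L :=
    (dvd_sub_left hdvd).1 ((Dvd.intro_left (4 * g * w) hV.symm).trans hVL)
  rw [mul_comm] at hl
  have hlb : b ≤ l := by
    have hwl : w ≤ l := by
      refine le_of_mul_le_mul_right ?_ (show 0 < Y by lia)
      rw [← hl]
      refine le_trans ?_ hLV
      rw [hV]
      have : 1 * (w * Y) ≤ 4 * g * (w * Y) := by
        gcongr
        · exact mul_nonneg (by lia) (by lia)
        · lia
      linarith
    lia
  obtain ⟨U, hU⟩ : ∃ U : ℤ, U = P * L * X := ⟨_, rfl⟩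
  have hL1 : 1 ≤ L := by lia
  have hUrL : U = (P * X : ℕ) * L := by rw [hU]; push_cast; ring
  have hr2 : 2 ≤ P * X := by lia
  have hU2 : 2 ≤ U := by
    rw [hUrL]
    calc (2 : ℤ) = (2 : ℕ) * 1 := by norm_num
      _ ≤ (P * X : ℕ) * L := by gcongr
  -- the parameters `h` and `k`
  obtain ⟨A, hA⟩ : ∃ A : ℤ, A = U ^ Q * (V + 1) := ⟨_, rfl⟩
  obtain ⟨M, hM⟩ : ∃ M : ℤ, M = U ^ P * V := ⟨_, rfl⟩
  have hUA : U * V ≤ A := by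
    rw [hA]
    gcongr
    · exact le_self_pow₀ (by lia) (by lia)
    · lia
  have hUM : 2 * U * V ≤ M := by
    rw [hM]
    gcongr
    calc 2 * U ≤ U * U := by gcongr
      _ = U ^ 2 := (sq U).symm
      _ ≤ U ^ P := pow_le_pow_right₀ (by lia) (by lia)
  have hUV : 2 * 8 ≤ U * V := by gcongr
  have hA3 : 3 ≤ A := by lia
  have hM3 : 3 ≤ M := by linarith
  obtain ⟨h, hh⟩ := lucasU.sub_two_dvd A (P * X + 1)
  obtain ⟨k, hk⟩ := lucasU.sub_two_dvd M (Q * X + 1)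
  have hhb : b ≤ h := by
    have := lucasU.linear_le (a := A) (by lia) (P * X)
    have : ((P * X : ℕ) : ℤ) ≤ h := by
      refine le_of_mul_le_mul_left ?_ (show 0 < A - 2 by lia)
      rw [← hh]
      push_cast at *
      linarith
    lia
  have hkb : b ≤ k := by
    have := lucasU.linear_le (a := M) (by lia) (Q * X)
    have : ((Q * X : ℕ) : ℤ) ≤ k := by
      refine le_of_mul_le_mul_left ?_ (show 0 < M - 2 by lia)
      rw [← hk]
      push_cast at *
      linarith
    lia
  obtain ⟨x, y, hxb, hyb, hsq⟩ :=
    exists_mul_eq_sq (A := A) (b := b) (n := P * X) hA3 hb1 (by lia)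
  have hC : (P : ℤ) * X + 1 + (A - 2) * h = lucasU A (P * X + 1) := by
    rw [← hh]; push_cast; ring
  have hK : (Q : ℤ) * X + 1 + k * (M - 2) = lucasU M (Q * X + 1) := by
    rw [mul_comm k, ← hk]; push_cast; ring
  refine ⟨h, k, l, w, x, y, hhb, hkb, hlb, hwb, hxb, hyb, ?_⟩
  simp only [Int.toNat_natCast]
  rw [← hl, ← hU, ← hV, ← hM, ← hA, hC, hK, hPXdef]
  refine ⟨?_, ?_, ?_, hbw, ?_⟩
  · simpa only [hrdef] using hsq
  · refine ⟨2 * lucasU M (Q * X + 1 + 1) - M * lucasU M (Q * X + 1), ?_⟩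
    have hU2P : U ^ (2 * P) * V ^ 2 = M ^ 2 := by rw [hM]; ring
    rw [hU2P]
    linear_combination -4 * lucasU.norm_eq_one M (Q * X + 1)
  · rw [hbw]
    exact lucasU.dvd_mul_pow_sub A p (P * X + 1)
  · have hAM : A ^ (P * X) * V ^ (Q * X) = M ^ (Q * X) * (V + 1) ^ (P * X) := by
      rw [hA, hM, mul_pow, mul_pow, ← pow_mul, ← pow_mul,
        show Q * (P * X) = P * (Q * X) by ring]
      ring
    have key := abs_sub_lt_of_add_one_pow_eq (V := V) (L := L) (A := A) (M := M)
      (C := lucasU A (P * X + 1)) (K := lucasU M (Q * X + 1)) (e := e) (r := P * X) (s := Q * X)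
      (g := g) (mod_cast hg) hr2 (by lia) (mod_cast hL1) (mod_cast hVr) (mod_cast hLe)
      (mod_cast he₀) (mod_cast heV) (by rw [hUrL] at hUA; exact_mod_cast hUA)
      (by rw [hUrL, ← mul_assoc] at hUM; exact_mod_cast hUM) (mod_cast hAM)
      (mod_cast lucasU.pow_le (by lia) _) (mod_cast lucasU.le_pow (by lia) _)
      (mod_cast lucasU.pow_le (by lia) _) (mod_cast lucasU.le_pow (by lia) _)
    have key' : 4 * g * |lucasU A (P * X + 1) - lucasU M (Q * X + 1) * L| <
        lucasU M (Q * X + 1) := by exact_mod_cast key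
    calc _ = (4 * g * |lucasU A (P * X + 1) - lucasU M (Q * X + 1) * L|) ^ 2 := by
          rw [mul_pow, sq_abs]; ring
      _ < _ := by gcongr
end
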